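/- Let T ≥ 2 and β_2, …, β_T ∈ ℝ. The maximum of l_1 + ∑_{t=2}^T (1 − β_t)·l_t over l ∈ U^CLT exists (is attained) and equals L^CLT · max(1, max_{2≤t≤T} (1 − β_t)). -/

import Mathlib

/-- The CLT uncertainty set: losses `l : {1,…,T} → ℝ` with `l t ≥ 0` and
`|∑_{t=1}^T l t − T·m̄| ≤ γ₂·σ·√T`. -/
def UCLT (T : ℕ) (m σ γ₂ : ℝ) (l : ℕ → ℝ) : Prop :=
  (∀ t ∈ Finset.Icc 1 T, 0 ≤ l t) ∧
    |(∑ t ∈ Finset.Icc 1 T, l t) - (T : ℝ) * m| ≤ γ₂ * σ * Real.sqrt T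

/-- `L^CLT = T·m̄ + γ₂·σ·√T`. -/
noncomputable def LCLT (T : ℕ) (m σ γ₂ : ℝ) : ℝ :=
  (T : ℝ) * m + γ₂ * σ * Real.sqrt T

theorem LCLT_nonneg (T : ℕ) {m σ γ₂ : ℝ} (hm : 0 ≤ m) (hσ : 0 ≤ σ) (hγ : 0 ≤ γ₂) :
    0 ≤ LCLT T m σ γ₂ := by
  unfold LCLT
  positivity

theorem UCLT.sum_le_LCLT {T : ℕ} {m σ γ₂ : ℝ} {l : ℕ → ℝ} (h : UCLT T m σ γ₂ l) :
    ∑ t ∈ Finset.Icc 1 T, l t ≤ LCLT T m σ γ₂ := by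
  unfold LCLT
  linarith [(abs_le.mp h.2).2]

/-- Concentrating the whole worst-case loss `L^CLT` in one period is feasible. -/
theorem UCLT_single {T : ℕ} {m σ γ₂ : ℝ} (hm : 0 ≤ m) (hσ : 0 ≤ σ) (hγ : 0 ≤ γ₂)
    {k : ℕ} (hk : k ∈ Finset.Icc 1 T) :
    UCLT T m σ γ₂ (Pi.single k (LCLT T m σ γ₂)) := by
  have h_nonneg : (0 : ℕ → ℝ) ≤ Pi.single k (LCLT T m σ γ₂) :=
    Pi.single_nonneg.mpr (LCLT_nonneg T hm hσ hγ)
  refine ⟨fun t _ => h_nonneg t, ?_⟩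
  rw [Finset.sum_pi_single', if_pos hk, LCLT, add_sub_cancel_left, abs_of_nonneg (by positivity)]

theorem sum_Icc_one_eq_add_sum_Icc_two {T : ℕ} (hT : 1 ≤ T) (f : ℕ → ℝ) :
    ∑ t ∈ Finset.Icc 1 T, f t = f 1 + ∑ t ∈ Finset.Icc 2 T, f t := by
  rw [← Finset.add_sum_Ioc_eq_sum_Icc hT]
  rfl

/-- The maximum of `l 1 + ∑_{t=2}^T (1 − β t)·l t` over `l ∈ U^CLT` is attained and
equals `L^CLT · max(1, max_{2≤t≤T} (1 − β t))`. -/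
theorem clt_coverage_max_attained (T : ℕ) (hT2 : 2 ≤ T) (m σ γ₂ : ℝ)
    (hm : 0 ≤ m) (hσ : 0 ≤ σ) (hγ : 0 ≤ γ₂) (β : ℕ → ℝ) :
    ∃ l : ℕ → ℝ, UCLT T m σ γ₂ l ∧
      (l 1 + ∑ t ∈ Finset.Icc 2 T, (1 - β t) * l t) =
        LCLT T m σ γ₂ *
          max 1 ((Finset.Icc 2 T).sup' (Finset.nonempty_Icc.mpr hT2) (fun t => 1 - β t)) ∧
      ∀ l' : ℕ → ℝ, UCLT T m σ γ₂ l' →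
        (l' 1 + ∑ t ∈ Finset.Icc 2 T, (1 - β t) * l' t) ≤
          LCLT T m σ γ₂ *
            max 1 ((Finset.Icc 2 T).sup' (Finset.nonempty_Icc.mpr hT2) (fun t => 1 - β t)) := by
  set M := (Finset.Icc 2 T).sup' (Finset.nonempty_Icc.mpr hT2) (fun t => 1 - β t) with hM
  have hbound : ∀ l' : ℕ → ℝ, UCLT T m σ γ₂ l' →
      (l' 1 + ∑ t ∈ Finset.Icc 2 T, (1 - β t) * l' t) ≤ LCLT T m σ γ₂ * max 1 M := by
    intro l hl
    have h_one : l 1 ≤ max 1 M * l 1 :=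
      le_mul_of_one_le_left (hl.1 1 (Finset.mem_Icc.mpr ⟨le_rfl, by omega⟩)) (le_max_left _ _)
    have h_rest : ∑ t ∈ Finset.Icc 2 T, (1 - β t) * l t ≤
        ∑ t ∈ Finset.Icc 2 T, max 1 M * l t := by
      refine Finset.sum_le_sum fun t ht => mul_le_mul_of_nonneg_right ?_
        (hl.1 t (Finset.Icc_subset_Icc_left one_le_two ht))
      exact (Finset.le_sup' (fun t => 1 - β t) ht).trans (le_max_right _ _)
    calc l 1 + ∑ t ∈ Finset.Icc 2 T, (1 - β t) * l t
        ≤ max 1 M * ∑ t ∈ Finset.Icc 1 T, l t := by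
          rw [sum_Icc_one_eq_add_sum_Icc_two (by omega), mul_add, Finset.mul_sum]
          exact add_le_add h_one h_rest
      _ ≤ max 1 M * LCLT T m σ γ₂ :=
          mul_le_mul_of_nonneg_left hl.sum_le_LCLT (zero_le_one.trans (le_max_left _ _))
      _ = LCLT T m σ γ₂ * max 1 M := mul_comm _ _
  obtain ⟨k, hk, hkM⟩ := Finset.exists_mem_eq_sup' (Finset.nonempty_Icc.mpr hT2)
    (fun t => 1 - β t)
  rw [← hM] at hkM
  rcases le_total M 1 with h | h
  · refine ⟨Pi.single 1 (LCLT T m σ γ₂),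
      UCLT_single hm hσ hγ (Finset.mem_Icc.mpr ⟨le_rfl, by omega⟩), ?_, hbound⟩
    rw [max_eq_left h, Finset.sum_eq_zero, Pi.single_eq_same, add_zero, mul_one]
    intro t ht
    rw [Pi.single_eq_of_ne (by grind), mul_zero]
  · refine ⟨Pi.single k (LCLT T m σ γ₂),
      UCLT_single hm hσ hγ (Finset.Icc_subset_Icc_left one_le_two hk), ?_, hbound⟩
    rw [max_eq_right h, Pi.single_eq_of_ne (by grind), zero_add,
      Finset.sum_eq_single_of_mem k hk, Pi.single_eq_same, hkM, mul_comm]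
    intro t _ htk
    rw [Pi.single_eq_of_ne htk, mul_zero]
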